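/- Let κ, ε > 0, L > 0, M ≥ 1, h := L/M, and a_0 ≥ 0. For periodic grid functions φ and ℒ, define the functional G[z] := (a_0/2) ‖z − φ‖² + ⟨ℒ, z⟩ + (ε² κ/2) ‖∇_h z‖² + (κ/4) ‖z‖_{ℓ⁴}⁴ − (κ/2) ‖z‖² on periodic grid functions z. Then G is coercive: G[z] ≥ (κ/2) ‖z‖² − (9κ/4) L² − (1/(2κ)) ‖ℒ‖² for every periodic grid function z. -/

import Mathlib

/-- Periodic grid functions on an `M × M` periodic grid. -/
abbrev Grid (M : ℕ) := ZMod M → ZMod M → ℝ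

/-- Discrete Laplacian `(Δ_h v)_{i,j}`. -/
noncomputable def lapl (M : ℕ) (h : ℝ) (v : Grid M) : Grid M :=
  fun i j => (v (i + 1) j + v (i - 1) j + v i (j + 1) + v i (j - 1) - 4 * v i j) / h ^ 2

/-- Discrete inner product `⟨v, w⟩ := h² ∑_{i,j} v_{i,j} w_{i,j}`. -/
noncomputable def ip (M : ℕ) [NeZero M] (h : ℝ) (v w : Grid M) : ℝ :=
  h ^ 2 * ∑ i : ZMod M, ∑ j : ZMod M, v i j * w i j

/-- Discrete gradient norm squared `‖∇_h v‖²`. -/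
noncomputable def gradSq (M : ℕ) [NeZero M] (v : Grid M) : ℝ :=
  ∑ i : ZMod M, ∑ j : ZMod M,
    ((v (i + 1) j - v i j) ^ 2 + (v i (j + 1) - v i j) ^ 2)

/-- Discrete `ℓ⁴` norm to the fourth power `‖v‖_{ℓ⁴}⁴ := h² ∑_{i,j} v_{i,j}⁴`. -/
noncomputable def l4 (M : ℕ) [NeZero M] (h : ℝ) (v : Grid M) : ℝ :=
  h ^ 2 * ∑ i : ZMod M, ∑ j : ZMod M, (v i j) ^ 4

/-- Nonlinear chemical potential `μ := v³ - v - ε² Δ_h v` (pointwise). -/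
noncomputable def muF (M : ℕ) (ε h : ℝ) (v : Grid M) : Grid M :=
  fun i j => (v i j) ^ 3 - v i j - ε ^ 2 * lapl M h v i j

/-- Discrete free energy `E[v] := (ε²/2) ‖∇_h v‖² + (1/4) ‖v² - 1‖²`. -/
noncomputable def En (M : ℕ) [NeZero M] (ε h : ℝ) (v : Grid M) : ℝ :=
  ε ^ 2 / 2 * gradSq M v +
    1 / 4 * ip M h (fun i j => (v i j) ^ 2 - 1) (fun i j => (v i j) ^ 2 - 1)

/-- Completing the squares `(l + κ x)²` and `(x² - 3)²`. -/
theorem pointwise_coercive {κ : ℝ} (hκ : 0 < κ) (l x : ℝ) :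
    0 ≤ l * x + κ / 4 * x ^ 4 - κ * (x * x) + 9 * κ / 4 + 1 / (2 * κ) * (l * l) := by
  have key : l * x + κ / 4 * x ^ 4 - κ * (x * x) + 9 * κ / 4 + 1 / (2 * κ) * (l * l) =
      1 / (2 * κ) * (l + κ * x) ^ 2 + κ / 4 * (x ^ 2 - 3) ^ 2 := by
    field_simp
    ring
  rw [key]
  positivity

theorem ip_self_nonneg (M : ℕ) [NeZero M] (h : ℝ) (v : Grid M) : 0 ≤ ip M h v v :=
  mul_nonneg (sq_nonneg h)
    (Finset.sum_nonneg fun _ _ => Finset.sum_nonneg fun _ _ => mul_self_nonneg _)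

theorem gradSq_nonneg (M : ℕ) [NeZero M] (v : Grid M) : 0 ≤ gradSq M v :=
  Finset.sum_nonneg fun _ _ => Finset.sum_nonneg fun _ _ => by positivity

/-- Coercivity of the functional `G[z] := (a₀/2)‖z-φ‖² + ⟨ℒ,z⟩ + (ε²κ/2)‖∇_h z‖²
  + (κ/4)‖z‖_{ℓ⁴}⁴ - (κ/2)‖z‖²`:
`G[z] ≥ (κ/2)‖z‖² - (9κ/4)L² - (1/(2κ))‖ℒ‖²`. -/
theorem G_functional_coercive
    (L : ℝ) (hL : 0 < L) (M : ℕ) [NeZero M] (h : ℝ) (hh : h = L / M)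
    (κ ε a0 : ℝ) (hκ : 0 < κ) (hε : 0 < ε) (ha0 : 0 ≤ a0)
    (φ ℒ z : Grid M) :
    a0 / 2 * ip M h (z - φ) (z - φ) + ip M h ℒ z + ε ^ 2 * κ / 2 * gradSq M z +
        κ / 4 * l4 M h z - κ / 2 * ip M h z z ≥
      κ / 2 * ip M h z z - 9 * κ / 4 * L ^ 2 - 1 / (2 * κ) * ip M h ℒ ℒ := by
  have hφ : 0 ≤ a0 / 2 * ip M h (z - φ) (z - φ) :=
    mul_nonneg (by positivity) (ip_self_nonneg M h _)
  have hgrad : 0 ≤ ε ^ 2 * κ / 2 * gradSq M z :=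
    mul_nonneg (by positivity) (gradSq_nonneg M z)
  have hM : (M : ℝ) ≠ 0 := Nat.cast_ne_zero.mpr (NeZero.ne M)
  have hL2 : L ^ 2 = h ^ 2 * ((M : ℝ) * M) := by
    rw [hh]
    field_simp
  have hsum : 0 ≤ h ^ 2 * ∑ i : ZMod M, ∑ j : ZMod M,
      (ℒ i j * z i j + κ / 4 * z i j ^ 4 - κ * (z i j * z i j) + 9 * κ / 4
        + 1 / (2 * κ) * (ℒ i j * ℒ i j)) :=
    mul_nonneg (sq_nonneg h)
      (Finset.sum_nonneg fun _ _ => Finset.sum_nonneg fun _ _ => pointwise_coercive hκ _ _)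
  simp only [Finset.sum_add_distrib, Finset.sum_sub_distrib, ← Finset.mul_sum,
    Finset.sum_const, Finset.card_univ, ZMod.card, nsmul_eq_mul] at hsum
  have hlocal : 0 ≤ ip M h ℒ z + κ / 4 * l4 M h z - κ * ip M h z z + 9 * κ / 4 * L ^ 2
      + 1 / (2 * κ) * ip M h ℒ ℒ := by
    rw [hL2]
    unfold ip l4
    linarith
  linarith
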